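/- Let G be an α_i-metric graph and u an arbitrary vertex. Then every vertex v furthest from u (i.e., with d(u,v)=e(u)) satisfies e(v) ≥ diam(G)-3i-2. -/

import Mathlib

open SimpleGraph

variable {V : Type*}

/-- `Itv G u v x` means `x` lies on a shortest `(u,v)`-path, i.e. `x ∈ I(u,v)`. -/
def Itv (G : SimpleGraph V) (u v x : V) : Prop :=
  G.dist u x + G.dist x v = G.dist u v

/-- `G` is an `α_i`-metric graph. -/
def AlphaI (G : SimpleGraph V) (i : ℕ) : Prop :=
  ∀ u v w x : V, Itv G u w v → Itv G v x w → G.Adj v w →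
    G.dist u v + G.dist v x ≤ G.dist u x + i

/-- Eccentricity of a vertex. -/
noncomputable def ecc (G : SimpleGraph V) [Fintype V] (v : V) : ℕ :=
  Finset.univ.sup (fun u => G.dist v u)

/-- Radius of the graph. -/
noncomputable def grad (G : SimpleGraph V) [Fintype V] [Nonempty V] : ℕ :=
  Finset.univ.inf' Finset.univ_nonempty (fun v => ecc G v)

/-- Diameter of the graph. -/
noncomputable def gdiam (G : SimpleGraph V) [Fintype V] : ℕ :=
  Finset.univ.sup (fun v => ecc G v)

/-- A vertex at positive distance from `x` has a neighbour one step closer to `x`. -/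
theorem exists_adj_dist_eq {G : SimpleGraph V} (hG : G.Connected) {x c : V} {k : ℕ}
    (h : G.dist x c = k + 1) : ∃ z, G.Adj z c ∧ G.dist x z = k := by
  obtain ⟨p, hp⟩ := hG.exists_walk_length_eq_dist c x
  rw [G.dist_comm, h] at hp
  cases p with
  | nil => simp at hp
  | @cons _ z _ hadj q =>
    refine ⟨z, hadj.symm, ?_⟩
    have h₁ := SimpleGraph.dist_le q
    have h₂ := hG.dist_triangle (u := x) (v := z) (w := c)
    have h₃ := SimpleGraph.dist_eq_one_iff_adj.mpr hadj.symm
    rw [Walk.length_cons] at hp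
    rw [G.dist_comm] at h₁
    omega

/-- Every slice of the interval between two vertices is nonempty. -/
theorem exists_dist_eq_dist_eq {G : SimpleGraph V} (hG : G.Connected) (x y : V) (m : ℕ) :
    ∀ t, t + m = G.dist x y → ∃ c, G.dist x c = t ∧ G.dist c y = m := by
  induction m with
  | zero => exact fun t ht => ⟨y, ht.symm, SimpleGraph.dist_self⟩
  | succ m ih =>
    intro t ht
    obtain ⟨c, hxc, hcy⟩ := ih (t + 1) (by omega)
    obtain ⟨z, hadj, hz⟩ := exists_adj_dist_eq hG hxc
    have h₁ := hG.dist_triangle (u := z) (v := c) (w := y)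
    have h₂ := hG.dist_triangle (u := x) (v := z) (w := y)
    have h₃ := SimpleGraph.dist_eq_one_iff_adj.mpr hadj
    exact ⟨z, hz, by omega⟩

/-- Slices of intervals of an `α_i`-metric graph have diameter at most `i + 1`. -/
theorem AlphaI.dist_le_of_slice {G : SimpleGraph V} (hG : G.Connected) {i : ℕ}
    (hα : AlphaI G i) (x y : V) (t : ℕ) :
    ∀ m c c', t + m = G.dist x y → G.dist x c = t → G.dist c y = m → G.dist x c' = t →
      G.dist c' y = m → G.dist c c' ≤ i + 1 := by
  induction t with
  | zero =>
    intro m c c' _ hc _ hc' _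
    rw [hG.dist_eq_zero_iff] at hc hc'
    subst hc hc'
    simp
  | succ t ih =>
    intro m c c' hn hxc hcy hxc' hcy'
    obtain ⟨z, hz, hxz⟩ := exists_adj_dist_eq hG hxc
    obtain ⟨z', hz', hxz'⟩ := exists_adj_dist_eq hG hxc'
    have h₁ := SimpleGraph.dist_eq_one_iff_adj.mpr hz
    have h₁' := SimpleGraph.dist_eq_one_iff_adj.mpr hz'
    have hzy : G.dist z y = m + 1 := by
      have := hG.dist_triangle (u := z) (v := c) (w := y)
      have := hG.dist_triangle (u := x) (v := z) (w := y)
      omega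
    have hzy' : G.dist z' y = m + 1 := by
      have := hG.dist_triangle (u := z') (v := c') (w := y)
      have := hG.dist_triangle (u := x) (v := z') (w := y)
      omega
    have hzz' := ih (m + 1) z z' (by omega) hxz hzy hxz' hzy'
    by_contra! hlt
    have htri := hG.dist_triangle (u := z) (v := z') (w := c')
    have htri' := hG.dist_triangle (u := c) (v := z) (w := c')
    have hcz := G.dist_comm (u := c) (v := z)
    have hcc' := G.dist_comm (u := c) (v := c')
    have hzc' := G.dist_comm (u := z) (v := c')
    have hle : i + 2 ≤ G.dist z c' := by
      by_contra! hlt'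
      have := hα c' z c y (by unfold Itv; omega) (by unfold Itv; omega) hz
      omega
    have := hα z z' c' y (by unfold Itv; omega) (by unfold Itv; omega) hz'
    omega

/-- Every slice of an interval `I(x,y)` of an `α_i`-metric graph contains a vertex lying, up to an
error `i`, between `v` and one of the ends `x`, `y`. -/
theorem AlphaI.exists_slice_dist_add_dist_le {G : SimpleGraph V} (hG : G.Connected) {i : ℕ}
    (hα : AlphaI G i) (x y v : V) {t m : ℕ} (hn : t + m = G.dist x y) :
    ∃ c, G.dist x c = t ∧ G.dist c y = m ∧
      (G.dist v c + m ≤ G.dist v y + i ∨ G.dist v c + t ≤ G.dist v x + i) := by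
  obtain ⟨c, hxc, hcy⟩ := exists_dist_eq_dist_eq hG x y m t hn
  induction hk : G.dist v c generalizing c with
  | zero =>
    rw [hG.dist_eq_zero_iff] at hk
    subst hk
    exact ⟨v, hxc, hcy, Or.inl (by simp; omega)⟩
  | succ k ih =>
    obtain ⟨w, hw, hvw⟩ := exists_adj_dist_eq hG hk
    have hwc := SimpleGraph.dist_eq_one_iff_adj.mpr hw
    by_cases hs : G.dist x w = t ∧ G.dist w y = m
    · exact ih w hs.1 hs.2 hvw
    refine ⟨c, hxc, hcy, ?_⟩
    have hcw := G.dist_comm (u := c) (v := w)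
    have hcx := G.dist_comm (u := c) (v := x)
    have hwx := G.dist_comm (u := w) (v := x)
    have h₁ := hG.dist_triangle (u := w) (v := c) (w := y)
    have h₂ := hG.dist_triangle (u := x) (v := c) (w := w)
    have h₃ := hG.dist_triangle (u := x) (v := w) (w := y)
    by_cases hy : G.dist w y = m + 1
    · have := hα v w c y (by unfold Itv; omega) (by unfold Itv; omega) hw
      omega
    · have := hα v w c x (by unfold Itv; omega) (by unfold Itv; omega) hw
      omega

theorem dist_le_ecc [Fintype V] (G : SimpleGraph V) (v w : V) : G.dist v w ≤ ecc G v :=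
  Finset.le_sup (f := fun u => G.dist v u) (Finset.mem_univ w)

theorem stmt_11 [Fintype V] (G : SimpleGraph V) (hG : G.Connected) (i : ℕ)
    (hα : AlphaI G i) (u v : V) (hv : G.dist u v = ecc G u) :
    gdiam G ≤ ecc G v + 3 * i + 2 := by
  refine Finset.sup_le fun x _ => Finset.sup_le fun y _ => ?_
  obtain ⟨c, hxc, hcy, hc⟩ := hα.exists_slice_dist_add_dist_le hG x y v
    (t := G.dist x y / 2) (m := G.dist x y - G.dist x y / 2) (by omega)
  obtain ⟨c', hxc', hcy', hc'⟩ := hα.exists_slice_dist_add_dist_le hG x y u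
    (t := G.dist x y / 2) (m := G.dist x y - G.dist x y / 2) (by omega)
  have hcc' := hα.dist_le_of_slice hG x y _ _ c' c (by omega) hxc' hcy' hxc hcy
  have h₁ := hG.dist_triangle (u := u) (v := c') (w := v)
  have h₂ := hG.dist_triangle (u := c') (v := c) (w := v)
  have h₃ := G.dist_comm (u := c) (v := v)
  have hvx := dist_le_ecc G v x
  have hvy := dist_le_ecc G v y
  have hux := dist_le_ecc G u x
  have huy := dist_le_ecc G u y
  omega
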